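/- Let u ∈ L²(T³) with div u = 0, c ∈ C^α(T³) for some α ∈ (0,1), and ∇c ∈ L²-based spaces sufficient for the product to make sense. Then for every j ≥ 0, the Littlewood–Paley block satisfies ‖Δ_j(u·∇c)‖_{L²} ≤ C 2^{j(1−α)} ‖u‖_{L²} ‖c‖_{C^α}, with C independent of j. -/

import Mathlib

open MeasureTheory Complex Real

noncomputable section

abbrev Td (d : ℕ) := Fin d → ℝ

def box (d : ℕ) : Set (Td d) := Set.univ.pi fun _ => Set.Ioc (0:ℝ) 1

/-- `f` is `ℤ^d`-periodic. -/
def TPer {d : ℕ} (f : Td d → ℝ) : Prop :=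
  ∀ (x : Td d) (k : Fin d → ℤ), f (fun i => x i + k i) = f x

/-- The character `e^{2π i k·x}`. -/
def eK {d : ℕ} (k : Fin d → ℤ) (x : Td d) : ℂ :=
  Complex.exp (2 * Real.pi * Complex.I * ∑ i, (k i : ℂ) * (x i : ℂ))

/-- Fourier coefficient of a periodic function on the torus. -/
def fCoeff {d : ℕ} (f : Td d → ℝ) (k : Fin d → ℤ) : ℂ :=
  ∫ x in box d, (f x : ℂ) * Complex.exp (-(2 * Real.pi * Complex.I) * ∑ i, (k i : ℂ) * (x i : ℂ))

/-- Japanese bracket weight `(1+|k|²)^s`. -/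
def wt {d : ℕ} (s : ℝ) (k : Fin d → ℤ) : ℝ := (1 + ∑ i, ((k i : ℝ))^2) ^ s

def hsNormSq {d : ℕ} (s : ℝ) (f : Td d → ℝ) : ℝ :=
  ∑' k : Fin d → ℤ, wt s k * ‖fCoeff f k‖^2

/-- Sobolev `H^s` norm on the torus, via Fourier series. -/
def hsNorm {d : ℕ} (s : ℝ) (f : Td d → ℝ) : ℝ := Real.sqrt (hsNormSq s f)

/-- Membership in `H^s`. -/
def InHs {d : ℕ} (s : ℝ) (f : Td d → ℝ) : Prop :=
  Summable fun k : Fin d → ℤ => wt s k * ‖fCoeff f k‖^2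

def l2Norm {d : ℕ} (f : Td d → ℝ) : ℝ := Real.sqrt (∫ x in box d, (f x)^2)

def l2NormC {d : ℕ} (f : Td d → ℂ) : ℝ := Real.sqrt (∫ x in box d, ‖f x‖^2)

def linf {d : ℕ} (f : Td d → ℝ) : ℝ := ⨆ x : Td d, |f x|

/-- `i`-th partial derivative. -/
def pd {d : ℕ} (i : Fin d) (f : Td d → ℝ) (x : Td d) : ℝ := fderiv ℝ f x (Pi.single i 1)

/-- Laplacian. -/
def lap {d : ℕ} (f : Td d → ℝ) (x : Td d) : ℝ := ∑ i, pd i (pd i f) x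

/-- Pointwise Euclidean norm of the gradient. -/
def gn {d : ℕ} (f : Td d → ℝ) (x : Td d) : ℝ := Real.sqrt (∑ i, (pd i f x)^2)

/-- Euclidean norm of a frequency/point in `ℝ^d`. -/
def eN {d : ℕ} (ξ : Td d) : ℝ := Real.sqrt (∑ i, (ξ i)^2)

/-- Fourier multiplier with symbol `ψ`. -/
def FMul {d : ℕ} (ψ : Td d → ℝ) (f : Td d → ℝ) (x : Td d) : ℂ :=
  ∑' k : Fin d → ℤ, (ψ (fun i => (k i : ℝ)) : ℂ) * fCoeff f k * eK k x

/-- Littlewood–Paley block `Δ_j` (`j ≥ -1`), built from a low-frequency cutoff `χ`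
(for `j = -1`) and a dyadic annulus bump `φ` (for `j ≥ 0`). -/
def LPblock {d : ℕ} (χ φ : Td d → ℝ) (j : ℤ) (f : Td d → ℝ) (x : Td d) : ℂ :=
  if j = -1 then FMul χ f x
  else FMul (fun ξ => φ (fun i => ξ i / 2 ^ j)) f x

/-- `(χ, φ)` is an admissible Littlewood–Paley pair: smooth symbols, `φ` supported in
the annulus `3/4 ≤ |ξ| ≤ 8/3`, `χ` supported in the ball `|ξ| ≤ 4/3`, and
`χ(ξ) + Σ_{j≥0} φ(2^{-j}ξ) = 1`. -/
def LPpair {d : ℕ} (χ φ : Td d → ℝ) : Prop :=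
  ContDiff ℝ (⊤ : ℕ∞) χ ∧ ContDiff ℝ (⊤ : ℕ∞) φ ∧
  (∀ ξ : Td d, φ ξ ≠ 0 → 3/4 ≤ eN ξ ∧ eN ξ ≤ 8/3) ∧
  (∀ ξ : Td d, χ ξ ≠ 0 → eN ξ ≤ 4/3) ∧
  (∀ ξ : Td d, χ ξ + ∑' j : ℕ, φ (fun i => ξ i / 2 ^ j) = 1)

/-- Index set `j ≥ -1` for Littlewood–Paley blocks. -/
abbrev LPidx := {n : ℤ // -1 ≤ n}

/-- Besov-type Hölder norm `‖c‖_{C^α} = sup_{j≥-1} 2^{jα}‖Δ_j c‖_{L^∞}`. -/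
def holderN {d : ℕ} (χ φ : Td d → ℝ) (α : ℝ) (c : Td d → ℝ) : ℝ :=
  ⨆ j : LPidx, (2:ℝ) ^ ((j.1 : ℝ) * α) * ⨆ x : Td d, ‖LPblock χ φ j.1 c x‖


lemma eK_norm {d : ℕ} (k : Fin d → ℤ) (x : Td d) : ‖eK k x‖ = 1 := by
  have : (2 * (Real.pi:ℂ) * Complex.I * ∑ i, (k i : ℂ) * (x i : ℂ))
      = ((2 * Real.pi * ∑ i, (k i : ℝ) * x i : ℝ) : ℂ) * Complex.I := by
    push_cast; ring
  rw [eK, this, Complex.norm_exp_ofReal_mul_I]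

lemma eK_add {d : ℕ} (k m : Fin d → ℤ) (x : Td d) : eK (k + m) x = eK k x * eK m x := by
  simp only [eK, ← Complex.exp_add, Pi.add_apply, Int.cast_add, add_mul, Finset.sum_add_distrib,
    mul_add]

lemma eK_zero {d : ℕ} (x : Td d) : eK 0 x = 1 := by
  simp [eK]

lemma eK_neg {d : ℕ} (k : Fin d → ℤ) (x : Td d) : eK (-k) x = (starRingEnd ℂ) (eK k x) := by
  have h : (2 * (Real.pi:ℂ) * Complex.I * ∑ i, (k i : ℂ) * (x i : ℂ))
      = ((2 * Real.pi * ∑ i, (k i : ℝ) * x i : ℝ) : ℂ) * Complex.I := by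
    push_cast; ring
  have h' : (2 * (Real.pi:ℂ) * Complex.I * ∑ i, ((-k) i : ℂ) * (x i : ℂ))
      = (starRingEnd ℂ) (((2 * Real.pi * ∑ i, (k i : ℝ) * x i : ℝ) : ℂ) * Complex.I) := by
    rw [map_mul, Complex.conj_ofReal, Complex.conj_I]
    push_cast; simp [Finset.sum_neg_distrib]; ring
  rw [eK, eK, h, ← Complex.exp_conj, ← h']

lemma eK_per {d : ℕ} (k : Fin d → ℤ) (x : Td d) (m : Fin d → ℤ) :
    eK k (fun i => x i + m i) = eK k x := by
  have : (2 * (Real.pi:ℂ) * Complex.I * ∑ i, (k i : ℂ) * ((x i + m i : ℝ) : ℂ))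
      = (2 * (Real.pi:ℂ) * Complex.I * ∑ i, (k i : ℂ) * (x i : ℂ))
       + ((∑ i, k i * m i : ℤ) : ℂ) * (2 * Real.pi * Complex.I) := by
    push_cast; simp only [mul_add, Finset.sum_add_distrib]; ring
  rw [eK, this, Complex.exp_add, Complex.exp_int_mul_two_pi_mul_I, mul_one, eK]

lemma eK_shift {d : ℕ} (k : Fin d → ℤ) (x : Td d) (i : Fin d) (t : ℝ) :
    eK k (x + Pi.single i t) = eK k x * Complex.exp (2 * Real.pi * Complex.I * ((k i : ℂ) * t)) := by
  have : ∑ l, (k l : ℂ) * (((x + Pi.single i t : Td d) l : ℝ) : ℂ)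
      = ∑ l, (k l : ℂ) * (x l : ℂ) + (k i : ℂ) * t := by
    simp only [Pi.add_apply, Complex.ofReal_add, mul_add, Finset.sum_add_distrib]
    congr 1
    rw [Finset.sum_eq_single i]
    · simp
    · intro b _ hb; simp [hb]
    · simp
  rw [eK, this, mul_add, Complex.exp_add, eK]

lemma eK_contDiff {d : ℕ} (k : Fin d → ℤ) : ContDiff ℝ (⊤ : ℕ∞) (eK k) := by
  unfold eK
  have : ∀ i : Fin d, ContDiff ℝ (⊤ : ℕ∞) (fun x : Td d => ((x i : ℝ) : ℂ)) := fun i =>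
    Complex.ofRealCLM.contDiff.comp (contDiff_apply ℝ ℝ i)
  apply ContDiff.cexp
  exact contDiff_const.mul (ContDiff.sum fun i _ => contDiff_const.mul (this i))

lemma eK_cont {d : ℕ} (k : Fin d → ℤ) : Continuous (eK k) := (eK_contDiff k).continuous

lemma eK_fderiv {d : ℕ} (k : Fin d → ℤ) (x : Td d) (i : Fin d) :
    fderiv ℝ (eK k) x (Pi.single i 1) = 2 * Real.pi * Complex.I * (k i : ℂ) * eK k x := by
  have hd : DifferentiableAt ℝ (eK k) x := (eK_contDiff k).differentiable (by simp) x
  have h1 : HasDerivAt (fun t : ℝ => eK k (x + t • (Pi.single i 1 : Td d)))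
      (fderiv ℝ (eK k) x (Pi.single i 1)) 0 := by
    have := hd.hasFDerivAt.hasLineDerivAt (Pi.single i 1 : Td d)
    exact this
  have h2 : HasDerivAt (fun t : ℝ => eK k (x + t • (Pi.single i 1 : Td d)))
      (2 * Real.pi * Complex.I * (k i : ℂ) * eK k x) 0 := by
    have e : (fun t : ℝ => eK k (x + t • (Pi.single i 1 : Td d))) =
        fun t : ℝ => eK k x * Complex.exp (2 * Real.pi * Complex.I * ((k i : ℂ) * t)) := by
      ext t
      rw [← eK_shift]; congr 2; ext l
      by_cases h : l = i
      · subst h; simp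
      · simp [h]
    rw [e]
    have h3 : HasDerivAt (fun t : ℝ => 2 * Real.pi * Complex.I * ((k i : ℂ) * (t:ℂ)))
       (2 * Real.pi * Complex.I * ((k i : ℂ) * 1)) 0 :=
      ((Complex.ofRealCLM.hasDerivAt (x := (0:ℝ))).const_mul _).const_mul _
    have := (h3.cexp).const_mul (eK k x)
    refine this.congr_deriv ?_
    simp; ring
  exact h1.unique h2

/-- box vs closed box. -/
lemma box_ae : (box 3 : Set (Td 3)) =ᵐ[volume] Set.Icc (0 : Td 3) 1 := by
  have := Measure.univ_pi_Ioc_ae_eq_Icc (μ := fun _ : Fin 3 => (volume : Measure ℝ))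
    (f := fun _ => 0) (g := fun _ => 1)
  exact this

lemma box_int {E : Type*} [NormedAddCommGroup E] {f : Td 3 → E} (hf : Continuous f) :
    IntegrableOn f (box 3) := by
  have : IntegrableOn f (Set.Icc (0 : Td 3) 1) := hf.continuousOn.integrableOn_Icc
  exact this.congr_set_ae box_ae

lemma box_vol : (volume.restrict (box 3)) Set.univ = 1 := by
  rw [Measure.restrict_apply_univ, box, volume_pi_pi]; simp

instance box_prob : IsProbabilityMeasure (volume.restrict (box 3)) := ⟨box_vol⟩

/-- integral of a partial derivative of a periodic function vanishes -/
lemma int_pd_zero (g : Td 3 → ℂ) (hg : ContDiff ℝ 1 g)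
    (hp : ∀ (x : Td 3) (k : Fin 3 → ℤ), g (fun i => x i + k i) = g x) (i : Fin 3) :
    ∫ x in box 3, fderiv ℝ g x (Pi.single i 1) = 0 := by
  classical
  rw [setIntegral_congr_set box_ae]
  have hc : Continuous fun x => fderiv ℝ g x (Pi.single i 1) :=
    (hg.continuous_fderiv (by simp)).clm_apply continuous_const
  have key := integral_divergence_of_hasFDerivAt_off_countable' (0 : Td 3) 1 (by simp)
    (fun l => if l = i then g else 0) (fun l x => if l = i then fderiv ℝ g x else 0) ∅
    (by simp) (fun l => by
      by_cases h : l = i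
      · simp only [h, if_true]; exact hg.continuous.continuousOn
      · simp only [h, if_false]; exact continuousOn_const)
    (fun x _ l => by
      by_cases h : l = i
      · simp only [h, if_true]
        exact ((hg.differentiable (by simp)) x).hasFDerivAt
      · simp only [h, if_false]; exact hasFDerivAt_const _ _)
    (by
      have : (fun x : Td 3 => ∑ l, (if l = i then fderiv ℝ g x else 0) (Pi.single l 1))
          = fun x => fderiv ℝ g x (Pi.single i 1) := by
        ext x
        rw [Finset.sum_eq_single i] <;> simp +contextual
      rw [this]
      exact hc.continuousOn.integrableOn_Icc)
  have e1 : (fun x : Td 3 => ∑ l, (if l = i then fderiv ℝ g x else 0) (Pi.single l 1))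
          = fun x => fderiv ℝ g x (Pi.single i 1) := by
    ext x
    rw [Finset.sum_eq_single i] <;> simp +contextual
  rw [e1] at key
  rw [key]
  apply Finset.sum_eq_zero
  intro l _
  by_cases h : l = i
  · subst h
    simp only [if_true, sub_eq_zero]
    apply integral_congr_ae
    filter_upwards with y
    have := hp (l.insertNth ((0 : Td 3) l) y) (Pi.single l 1)
    rw [← this]
    congr 1
    ext m
    refine Fin.succAboveCases l ?_ (fun m => ?_) m
    · simp
    · simp
  · simp [h]

/-- Fourier coefficient of a complex-valued function. -/
def cF (f : Td 3 → ℂ) (k : Fin 3 → ℤ) : ℂ := ∫ x in box 3, f x * eK (-k) x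

lemma fCoeff_eq (f : Td 3 → ℝ) (k : Fin 3 → ℤ) : fCoeff f k = cF (fun x => (f x : ℂ)) k := by
  unfold fCoeff cF
  congr 1; ext x; congr 1
  unfold eK; congr 1
  simp [Finset.sum_neg_distrib]

lemma fCoeff_pd (f : Td 3 → ℝ) (hf : ContDiff ℝ 1 f) (hp : TPer f) (i : Fin 3) (k : Fin 3 → ℤ) :
    fCoeff (pd i f) k = 2 * Real.pi * Complex.I * (k i : ℂ) * fCoeff f k := by
  have hfc : ContDiff ℝ 1 (fun x => (f x : ℂ)) := Complex.ofRealCLM.contDiff.comp hf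
  have he : ContDiff ℝ 1 (eK (-k)) := (eK_contDiff (-k)).of_le (by simp)
  have h0 := int_pd_zero (fun x => (f x : ℂ) * eK (-k) x) (hfc.mul he)
    (fun x m => by simp only [eK_per]; rw [hp x m]) i
  have hd : ∀ x, fderiv ℝ (fun x => (f x : ℂ) * eK (-k) x) x (Pi.single i 1)
      = (pd i f x : ℂ) * eK (-k) x
        - 2 * Real.pi * Complex.I * (k i : ℂ) * ((f x : ℂ) * eK (-k) x) := by
    intro x
    have h1 : HasFDerivAt (fun x => (f x : ℂ)) (Complex.ofRealCLM.comp (fderiv ℝ f x)) x :=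
      Complex.ofRealCLM.hasFDerivAt.comp x ((hf.differentiable (by simp)) x).hasFDerivAt
    have h2 := ((he.differentiable (by simp)) x).hasFDerivAt
    have h3 : fderiv ℝ (fun x => (f x : ℂ) * eK (-k) x) x = _ := (h1.mul h2).fderiv
    rw [h3]
    simp only [_root_.add_apply, _root_.smul_apply, eK_fderiv,
      ContinuousLinearMap.comp_apply, Complex.ofRealCLM_apply, pd, smul_eq_mul]
    push_cast [Pi.neg_apply]; ring
  simp only [hd] at h0
  have hpc : Continuous (pd i f) := (hf.continuous_fderiv (by simp)).clm_apply continuous_const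
  rw [integral_sub, integral_const_mul, sub_eq_zero] at h0
  · rw [fCoeff_eq, fCoeff_eq]; exact h0
  · exact box_int ((Complex.continuous_ofReal.comp hpc).mul (eK_cont _))
  · exact box_int (continuous_const.mul (hfc.continuous.mul (eK_cont _)))

lemma int_eK (k : Fin 3 → ℤ) : ∫ x in box 3, eK k x = if k = 0 then 1 else 0 := by
  split_ifs with h
  · subst h; simp [eK_zero]
  · obtain ⟨i, hi⟩ := Function.ne_iff.1 h
    have := int_pd_zero (eK k) ((eK_contDiff k).of_le (by simp)) (fun x m => eK_per k x m) i
    simp only [eK_fderiv] at this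
    rw [integral_const_mul] at this
    have hne : (2 * (Real.pi:ℂ) * Complex.I * (k i : ℂ)) ≠ 0 := by
      have : (k i : ℂ) ≠ 0 := by exact_mod_cast hi
      simp [Real.pi_ne_zero, this]
    exact (mul_eq_zero.1 this).resolve_left hne

/-- trigonometric polynomial -/
def trig (S : Finset (Fin 3 → ℤ)) (a : (Fin 3 → ℤ) → ℂ) (x : Td 3) : ℂ := ∑ k ∈ S, a k * eK k x

lemma trig_cont (S : Finset (Fin 3 → ℤ)) (a : (Fin 3 → ℤ) → ℂ) : Continuous (trig S a) :=
  continuous_finsetSum _ fun k _ => continuous_const.mul (eK_cont k)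

lemma int_mul_conj_trig (f : Td 3 → ℂ) (hf : Continuous f) (S : Finset (Fin 3 → ℤ))
    (a : (Fin 3 → ℤ) → ℂ) :
    ∫ x in box 3, f x * (starRingEnd ℂ) (trig S a x) = ∑ k ∈ S, cF f k * (starRingEnd ℂ) (a k) := by
  simp only [trig, map_sum, map_mul, ← eK_neg, Finset.mul_sum]
  rw [integral_finsetSum]
  · apply Finset.sum_congr rfl; intro k _
    rw [cF, ← integral_mul_const]; congr 1; ext x; ring
  · intro k _
    exact box_int (hf.mul (continuous_const.mul (eK_cont _)))

lemma cF_trig (S : Finset (Fin 3 → ℤ)) (a : (Fin 3 → ℤ) → ℂ) (k : Fin 3 → ℤ) :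
    cF (trig S a) k = if k ∈ S then a k else 0 := by
  simp only [cF, trig, Finset.sum_mul, mul_assoc, ← eK_add]
  rw [integral_finsetSum]
  · simp only [integral_const_mul, int_eK, add_neg_eq_zero]
    simp
  · intro m _
    exact box_int (continuous_const.mul (eK_cont _))

lemma parseval (S : Finset (Fin 3 → ℤ)) (a : (Fin 3 → ℤ) → ℂ) :
    ∫ x in box 3, ‖trig S a x‖^2 = ∑ k ∈ S, ‖a k‖^2 := by
  have := int_mul_conj_trig (trig S a) (trig_cont S a) S a
  simp only [Complex.mul_conj, Complex.normSq_eq_norm_sq] at this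
  rw [integral_complex_ofReal] at this
  apply Complex.ofReal_injective
  rw [this]; push_cast
  apply Finset.sum_congr rfl; intro k hk
  rw [cF_trig, if_pos hk, Complex.mul_conj, Complex.normSq_eq_norm_sq]; push_cast; rfl

lemma bessel (f : Td 3 → ℂ) (hf : Continuous f) (S : Finset (Fin 3 → ℤ)) :
    ∑ k ∈ S, ‖cF f k‖^2 ≤ ∫ x in box 3, ‖f x‖^2 := by
  set P := trig S (cF f) with hP
  have hPc : Continuous P := trig_cont _ _
  have h0 : 0 ≤ ∫ x in box 3, ‖f x - P x‖^2 := integral_nonneg fun x => by positivity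
  have e : ∀ x, ‖f x - P x‖^2 = ‖f x‖^2 + ‖P x‖^2 - 2 * (f x * (starRingEnd ℂ) (P x)).re := by
    intro x
    rw [← Complex.normSq_eq_norm_sq, Complex.normSq_sub, Complex.normSq_eq_norm_sq,
      Complex.normSq_eq_norm_sq]
  have hi : Continuous fun x => f x * (starRingEnd ℂ) (P x) :=
    hf.mul (Complex.continuous_conj.comp hPc)
  simp only [e] at h0
  rw [integral_sub, integral_add, parseval, integral_const_mul] at h0
  · have h1 : ∫ x in box 3, (f x * (starRingEnd ℂ) (P x)).re = ∑ k ∈ S, ‖cF f k‖^2 := by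
      have h2 := int_mul_conj_trig f hf S (cF f)
      have h3 : ∫ x in box 3, (f x * (starRingEnd ℂ) (P x)).re
          = (∫ x in box 3, (f x * (starRingEnd ℂ) (P x))).re :=
        (integral_re (box_int hi).integrable)
      rw [h3, h2]
      simp only [Complex.mul_conj, Complex.normSq_eq_norm_sq, Complex.re_sum, Complex.ofReal_re]
    rw [h1] at h0
    linarith
  · exact box_int (hf.norm.pow 2)
  · exact box_int (hPc.norm.pow 2)
  · exact box_int ((hf.norm.pow 2).add (hPc.norm.pow 2))
  · exact box_int (continuous_const.mul (Complex.continuous_re.comp hi))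

lemma root_sum (M : ℕ) (hM : 0 < M) (n : ℤ) :
    ∑ l ∈ Finset.range M, Complex.exp (2 * Real.pi * Complex.I * ((n : ℂ) * ((l / M : ℝ) : ℂ)))
      = if (M : ℤ) ∣ n then (M : ℂ) else 0 := by
  set z := Complex.exp (2 * Real.pi * Complex.I * ((n : ℂ) / M)) with hz
  have hM' : (M : ℂ) ≠ 0 := by exact_mod_cast hM.ne'
  have e : ∀ l : ℕ, Complex.exp (2 * Real.pi * Complex.I * ((n : ℂ) * ((l / M : ℝ) : ℂ))) = z ^ l := by
    intro l
    rw [hz, ← Complex.exp_nat_mul]; congr 1; push_cast; field_simp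
  simp only [e]
  have hzM : z ^ M = 1 := by
    rw [hz, ← Complex.exp_nat_mul, ← Complex.exp_int_mul_two_pi_mul_I n]; congr 1; field_simp
  split_ifs with h
  · obtain ⟨q, rfl⟩ := h
    have : z = 1 := by
      rw [hz, ← Complex.exp_int_mul_two_pi_mul_I q]; congr 1; push_cast; field_simp
    simp [this]
  · have hz1 : z ≠ 1 := by
      intro hz1
      rw [hz, Complex.exp_eq_one_iff] at hz1
      obtain ⟨q, hq⟩ := hz1
      apply h; refine ⟨q, ?_⟩
      have h2 : (2 * (Real.pi:ℂ) * Complex.I) ≠ 0 := Complex.two_pi_I_ne_zero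
      have : (n : ℂ) / M = q := mul_left_cancel₀ h2 (by rw [hq]; ring)
      rw [div_eq_iff hM'] at this
      have : (n : ℂ) = ((M * q : ℤ) : ℂ) := by rw [this]; push_cast; ring
      exact_mod_cast this
    have := mul_neg_geom_sum z M
    rw [hzM, sub_self] at this
    exact (mul_eq_zero.1 this).resolve_left (sub_ne_zero.2 hz1.symm)

/-- e(n t) -/
def e1 (n : ℤ) (t : ℝ) : ℂ := Complex.exp (2 * Real.pi * Complex.I * ((n : ℂ) * (t : ℂ)))

lemma e1_add (n m : ℤ) (t : ℝ) : e1 (n + m) t = e1 n t * e1 m t := by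
  simp only [e1, ← Complex.exp_add]; congr 1; push_cast; ring

lemma e1_norm (n : ℤ) (t : ℝ) : ‖e1 n t‖ = 1 := by
  have : (2 * (Real.pi:ℂ) * Complex.I * ((n : ℂ) * (t : ℂ)))
      = ((2 * Real.pi * (n * t) : ℝ) : ℂ) * Complex.I := by push_cast; ring
  rw [e1, this, Complex.norm_exp_ofReal_mul_I]

lemma e1_neg (n : ℤ) (t : ℝ) : e1 (-n) t = (starRingEnd ℂ) (e1 n t) := by
  have h : e1 (-n) t * e1 n t = 1 := by rw [← e1_add]; simp [e1]
  have h2 : (starRingEnd ℂ) (e1 n t) * e1 n t = 1 := by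
    rw [mul_comm, Complex.mul_conj, Complex.normSq_eq_norm_sq, e1_norm]; simp
  have hne : e1 n t ≠ 0 := by rw [← norm_ne_zero_iff, e1_norm]; simp
  exact mul_right_cancel₀ hne (h.trans h2.symm)

/-- `N` times the Fejer kernel -/
def fej (N : ℕ) (t : ℝ) : ℂ :=
  ∑ a ∈ Finset.range N, ∑ b ∈ Finset.range N, e1 ((a : ℤ) - b) t

lemma fej_eq (N : ℕ) (t : ℝ) :
    fej N t = ((‖∑ a ∈ Finset.range N, e1 a t‖^2 : ℝ) : ℂ) := by
  rw [← Complex.normSq_eq_norm_sq, ← Complex.mul_conj, map_sum, Finset.sum_mul_sum, fej]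
  apply Finset.sum_congr rfl; intro a _
  apply Finset.sum_congr rfl; intro b _
  rw [sub_eq_add_neg, e1_add, e1_neg]

lemma fej_sum (N : ℕ) (hN : 0 < N) (n : ℤ) (hn : |n| ≤ 2 * N) :
    ∑ l ∈ Finset.range (3 * N), fej N (l / (3 * N : ℕ) : ℝ) * e1 n (l / (3 * N : ℕ) : ℝ)
      = (3 * N : ℕ) * ∑ a ∈ Finset.range N, ∑ b ∈ Finset.range N,
          (if (a : ℤ) - b + n = 0 then (1 : ℂ) else 0) := by
  simp only [fej, Finset.sum_mul, ← e1_add]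
  rw [Finset.sum_comm, Finset.mul_sum]
  apply Finset.sum_congr rfl; intro a ha
  rw [Finset.sum_comm, Finset.mul_sum]
  apply Finset.sum_congr rfl; intro b hb
  have := root_sum (3 * N) (by omega) (a - b + n)
  simp only [e1]
  rw [this]
  simp only [Finset.mem_range] at ha hb
  rw [abs_le] at hn
  have : ((3 * N : ℕ) : ℤ) ∣ (a : ℤ) - b + n ↔ (a : ℤ) - b + n = 0 := by
    constructor
    · intro h
      apply Int.eq_zero_of_abs_lt_dvd h
      rw [abs_lt]; push_cast; constructor <;> omega
    · intro h; rw [h]; exact dvd_zero _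
  simp only [this]
  split_ifs <;> simp

lemma count0 (N : ℕ) :
    ∑ a ∈ Finset.range N, ∑ b ∈ Finset.range N,
          (if (a : ℤ) - b + 0 = 0 then (1 : ℂ) else 0) = N := by
  have : ∀ a ∈ Finset.range N, ∑ b ∈ Finset.range N,
          (if (a : ℤ) - b + 0 = 0 then (1 : ℂ) else 0) = 1 := by
    intro a ha
    rw [Finset.sum_eq_single a]
    · simp
    · intro b _ hb; rw [if_neg]; omega
    · intro h; exact absurd ha h
  rw [Finset.sum_congr rfl this]; simp

lemma countpos (N : ℕ) (m : ℕ) (hm : m ≤ N) :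
    ∑ a ∈ Finset.range N, ∑ b ∈ Finset.range N,
          (if (a : ℤ) - b + (N - m) = 0 then (1 : ℂ) else 0) = m := by
  have : ∀ a ∈ Finset.range N, ∑ b ∈ Finset.range N,
          (if (a : ℤ) - b + (N - m) = 0 then (1 : ℂ) else 0) = if a < m then 1 else 0 := by
    intro a ha
    split_ifs with h
    · rw [Finset.sum_eq_single (a + (N - m))]
      · rw [if_pos]; omega
      · intro b _ hb; rw [if_neg]; omega
      · intro h'; simp at h'; omega
    · apply Finset.sum_eq_zero; intro b hb; rw [if_neg]; simp at hb; omega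
  rw [Finset.sum_congr rfl this, Finset.sum_ite, Finset.sum_const_zero, add_zero, Finset.sum_const]
  have : (Finset.range N).filter (fun a => a < m) = Finset.range m := by
    ext a; simp; omega
  rw [this]; simp

lemma count_symm (N : ℕ) (n : ℤ) :
    ∑ a ∈ Finset.range N, ∑ b ∈ Finset.range N, (if (a : ℤ) - b + n = 0 then (1 : ℂ) else 0)
    = ∑ a ∈ Finset.range N, ∑ b ∈ Finset.range N, (if (a : ℤ) - b + -n = 0 then (1 : ℂ) else 0) := by
  rw [Finset.sum_comm]
  apply Finset.sum_congr rfl; intro a _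
  apply Finset.sum_congr rfl; intro b _
  have : (b : ℤ) - a + n = 0 ↔ (a : ℤ) - b + -n = 0 := by omega
  simp only [this]

lemma countbig (N : ℕ) (n : ℤ) (hn : (N : ℤ) ≤ n) :
    ∑ a ∈ Finset.range N, ∑ b ∈ Finset.range N,
          (if (a : ℤ) - b + n = 0 then (1 : ℂ) else 0) = 0 := by
  apply Finset.sum_eq_zero; intro a ha
  apply Finset.sum_eq_zero; intro b hb; rw [if_neg]; simp at hb; omega

lemma countdiff (N : ℕ) (m : ℤ) (hm : |m| ≤ N) :
    ∑ a ∈ Finset.range N, ∑ b ∈ Finset.range N,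
          (if (a : ℤ) - b + (N - m) = 0 then (1 : ℂ) else 0)
    - ∑ a ∈ Finset.range N, ∑ b ∈ Finset.range N,
          (if (a : ℤ) - b + (-N - m) = 0 then (1 : ℂ) else 0) = m := by
  rw [abs_le] at hm
  rw [count_symm N (-N - m)]
  rcases le_total 0 m with h | h
  · lift m to ℕ using h
    rw [countpos N m (by omega), countbig N _ (by omega)]; simp
  · obtain ⟨q, rfl⟩ : ∃ q : ℕ, m = -q := ⟨m.natAbs, by omega⟩
    have : (-(-(N : ℤ) - -q)) = N - q := by ring
    rw [this, countpos N q (by omega), countbig N _ (by omega)]; simp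

lemma bern_weights (N : ℕ) (hN : 0 < N) : ∃ w : ℕ → ℂ,
    ∑ l ∈ Finset.range (3 * N), ‖w l‖ ≤ 2 * N ∧
    ∀ m : ℤ, |m| ≤ N → ∑ l ∈ Finset.range (3 * N), w l * e1 m (-(l / (3 * N : ℕ) : ℝ)) = m := by
  set t : ℕ → ℝ := fun l => (l / (3 * N : ℕ) : ℝ) with ht
  have hM : ((3 * N : ℕ) : ℂ) ≠ 0 := by exact_mod_cast (by omega : 3 * N ≠ 0)
  have hMr : (0:ℝ) < ((3 * N : ℕ) : ℝ) := by exact_mod_cast (by omega : 0 < 3 * N)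
  refine ⟨fun l => fej N (t l) * (e1 N (t l) - e1 (-N) (t l)) / (3 * N : ℕ), ?_, ?_⟩
  · have h1 : ∀ l ∈ Finset.range (3 * N),
        ‖fej N (t l) * (e1 N (t l) - e1 (-N) (t l)) / (3 * N : ℕ)‖
          ≤ 2 * ((fej N (t l)).re / (3 * N : ℕ)) := by
      intro l _
      rw [norm_div, norm_mul, Complex.norm_natCast]
      have h2 : ‖e1 N (t l) - e1 (-N) (t l)‖ ≤ 2 := by
        refine (norm_sub_le _ _).trans ?_
        rw [e1_norm, e1_norm]; norm_num
      have h3 : ‖fej N (t l)‖ = (fej N (t l)).re := by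
        rw [fej_eq, Complex.norm_real, Complex.ofReal_re, Real.norm_of_nonneg (by positivity)]
      rw [← h3]
      rw [mul_div_assoc', div_le_div_iff_of_pos_right hMr, mul_comm 2]
      gcongr
    refine (Finset.sum_le_sum h1).trans ?_
    rw [← Finset.mul_sum, ← Finset.sum_div, ← Complex.re_sum]
    have := fej_sum N hN 0 (by simp)
    rw [count0] at this
    simp only [e1, Int.cast_zero, zero_mul, mul_zero, Complex.exp_zero, mul_one] at this
    have h4 : (∑ l ∈ Finset.range (3 * N), fej N (t l)) = ((((3 * N : ℕ) : ℝ) * N : ℝ) : ℂ) := by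
      rw [ht]; simp only; rw [this]; push_cast; ring
    rw [h4, Complex.ofReal_re, mul_div_cancel_left₀ _ hMr.ne']
  · intro m hm
    have hm' := abs_le.1 hm
    have h1 := fej_sum N hN (N - m) (by rw [abs_le]; constructor <;> omega)
    have h2 := fej_sum N hN (-N - m) (by rw [abs_le]; constructor <;> omega)
    have h3 := countdiff N m hm
    have e : ∀ s : ℝ, e1 m (-s) = e1 (-m) s := by intro s; simp [e1]
    have h4 : ∑ l ∈ Finset.range (3 * N), fej N (t l) * (e1 N (t l) - e1 (-N) (t l)) / (3 * N : ℕ)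
        * e1 m (-(l / (3 * N : ℕ) : ℝ)) =
        ((∑ l ∈ Finset.range (3 * N), fej N (t l) * e1 (N - m) (t l)) -
         ∑ l ∈ Finset.range (3 * N), fej N (t l) * e1 (-N - m) (t l)) / (3 * N : ℕ) := by
      rw [← Finset.sum_sub_distrib, Finset.sum_div]
      apply Finset.sum_congr rfl; intro l _
      rw [e, sub_eq_add_neg (N : ℤ) m, sub_eq_add_neg (-N : ℤ) m, e1_add, e1_add]
      ring
    rw [h4]
    simp only [ht]
    rw [h1, h2, ← mul_sub, h3, mul_div_cancel_left₀ _ hM]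

/-- Bernstein inequality for trigonometric polynomials. -/
lemma bern_ineq (S : Finset (Fin 3 → ℤ)) (a : (Fin 3 → ℤ) → ℂ) (i : Fin 3) (N : ℕ) (hN : 0 < N)
    (hS : ∀ k ∈ S, a k ≠ 0 → |k i| ≤ N) (A : ℝ) (hA : ∀ x, ‖trig S a x‖ ≤ A) (x : Td 3) :
    ‖trig S (fun k => (k i : ℂ) * a k) x‖ ≤ 2 * N * A := by
  obtain ⟨w, hw, hw2⟩ := bern_weights N hN
  have hA0 : 0 ≤ A := (norm_nonneg _).trans (hA x)
  have e : trig S (fun k => (k i : ℂ) * a k) x = ∑ l ∈ Finset.range (3 * N),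
      w l * trig S a (x + Pi.single i (-(l / (3 * N : ℕ) : ℝ))) := by
    simp only [trig, Finset.mul_sum]
    rw [Finset.sum_comm]
    apply Finset.sum_congr rfl; intro k hk
    by_cases h0 : a k = 0
    · simp [h0]
    rw [← hw2 (k i) (hS k hk h0), Finset.sum_mul, Finset.sum_mul]
    apply Finset.sum_congr rfl; intro l _
    rw [eK_shift, e1]; ring
  rw [e]
  calc _ ≤ ∑ l ∈ Finset.range (3 * N), ‖w l‖ * A := by
        refine (norm_sum_le _ _).trans (Finset.sum_le_sum fun l _ => ?_)
        rw [norm_mul]; gcongr; exact hA _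
    _ ≤ _ := by rw [← Finset.sum_mul]; gcongr

lemma pd_contDiff (f : Td 3 → ℝ) (hf : ContDiff ℝ (⊤ : ℕ∞) f) (i : Fin 3) :
    ContDiff ℝ (⊤ : ℕ∞) (pd i f) := by
  have : ContDiff ℝ (⊤ : ℕ∞) (fderiv ℝ f) := hf.fderiv_right (by simp)
  exact this.clm_apply contDiff_const

lemma pd_per (f : Td 3 → ℝ) (hp : TPer f) (i : Fin 3) : TPer (pd i f) := by
  intro x k
  have h : (fun y : Td 3 => f (y + fun i => (k i : ℝ))) = f := by
    ext y; exact hp y k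
  have h2 := fderiv_comp_add_right (𝕜 := ℝ) (f := f) (x := x) (fun i => (k i : ℝ))
  rw [h] at h2
  unfold pd; rw [h2]; rfl

lemma pd_iter (f : Td 3 → ℝ) (hf : ContDiff ℝ (⊤ : ℕ∞) f) (hp : TPer f) (i : Fin 3) (n : ℕ) :
    ContDiff ℝ (⊤ : ℕ∞) ((pd i)^[n] f) ∧ TPer ((pd i)^[n] f) ∧
    ∀ k, fCoeff ((pd i)^[n] f) k = (2 * Real.pi * Complex.I * (k i : ℂ)) ^ n * fCoeff f k := by
  induction n with
  | zero => exact ⟨hf, hp, fun k => by simp⟩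
  | succ n ih =>
    obtain ⟨h1, h2, h3⟩ := ih
    rw [Function.iterate_succ_apply']
    refine ⟨pd_contDiff _ h1 i, pd_per _ h2 i, fun k => ?_⟩
    rw [fCoeff_pd _ (h1.of_le (by simp)) h2, h3]; ring

lemma fCoeff_bdd (f : Td 3 → ℝ) (k : Fin 3 → ℤ) :
    ‖fCoeff f k‖ ≤ ∫ x in box 3, |f x| := by
  rw [fCoeff_eq, cF]
  refine (norm_integral_le_integral_norm _).trans (le_of_eq ?_)
  congr 1; ext x; rw [norm_mul, eK_norm, mul_one, Complex.norm_real, Real.norm_eq_abs]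

lemma decay (c : Td 3 → ℝ) (hc : ContDiff ℝ (⊤ : ℕ∞) c) (hp : TPer c) (n : ℕ) :
    ∃ D : ℝ, ∀ k : Fin 3 → ℤ, ‖k‖ ^ n * ‖fCoeff c k‖ ≤ D := by
  refine ⟨∑ i, ∫ x in box 3, |((pd i)^[n] c) x|, fun k => ?_⟩
  obtain ⟨i, -, hi⟩ := Finset.exists_max_image (Finset.univ : Finset (Fin 3)) (fun i => ‖k i‖) (by simp)
  have hk : ‖k‖ ≤ ‖k i‖ := (pi_norm_le_iff_of_nonneg (norm_nonneg _)).2 fun j => hi j (by simp)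
  have h1 := fCoeff_bdd ((pd i)^[n] c) k
  rw [(pd_iter c hc hp i n).2.2, norm_mul, norm_pow] at h1
  have h2 : ‖k i‖ ≤ ‖2 * (Real.pi:ℂ) * Complex.I * (k i : ℂ)‖ := by
    simp only [norm_mul, Complex.norm_I, Complex.norm_real, Complex.norm_intCast, Complex.norm_ofNat,
      mul_one, Int.norm_eq_abs, Real.norm_eq_abs, abs_of_pos Real.pi_pos]
    have := Real.pi_gt_three
    nlinarith [abs_nonneg (k i : ℝ)]
  calc _ ≤ ‖2 * (Real.pi:ℂ) * Complex.I * (k i : ℂ)‖ ^ n * ‖fCoeff c k‖ := by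
        gcongr; exact hk.trans h2
    _ ≤ _ := h1
    _ ≤ _ := Finset.single_le_sum (f := fun i => ∫ x in box 3, |((pd i)^[n] c) x|)
        (fun i _ => integral_nonneg fun x => abs_nonneg _) (Finset.mem_univ i)

lemma summable_g : Summable fun n : ℤ => (1 + (n:ℝ)^2)⁻¹ := by
  refine Summable.of_norm_bounded_eventually (Real.summable_one_div_int_pow.2 (by norm_num : 1 < 2)) ?_
  have : ∀ᶠ n : ℤ in Filter.cofinite, n ≠ 0 := by
    rw [Filter.eventually_cofinite]; simp
  filter_upwards [this] with n hn
  rw [Real.norm_of_nonneg (by positivity), ← one_div]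
  have : (0:ℝ) < (n:ℝ)^2 := by positivity
  gcongr; linarith

lemma summable_prod3 : Summable fun k : Fin 3 → ℤ => ∏ i, (1 + (k i:ℝ)^2)⁻¹ := by
  have h1 := summable_g.mul_of_nonneg (summable_g.mul_of_nonneg summable_g
    (fun n => by positivity) (fun n => by positivity)) (fun n => by positivity)
    (fun n => by simp only [Pi.zero_apply]; positivity)
  let e : (Fin 3 → ℤ) ≃ ℤ × ℤ × ℤ :=
    { toFun := fun k => (k 0, k 1, k 2)
      invFun := fun p => ![p.1, p.2.1, p.2.2]
      left_inv := fun k => by ext i; fin_cases i <;> rfl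
      right_inv := fun p => rfl }
  have := e.summable_iff.2 h1
  refine this.congr fun k => ?_
  rw [Fin.prod_univ_three, mul_assoc]; rfl

lemma summable_coeff (c : Td 3 → ℝ) (hc : ContDiff ℝ (⊤ : ℕ∞) c) (hp : TPer c) :
    Summable fun k : Fin 3 → ℤ => (1 + ‖k‖) * ‖fCoeff c k‖ := by
  obtain ⟨D0, h0⟩ := decay c hc hp 0
  obtain ⟨D7, h7⟩ := decay c hc hp 7
  refine Summable.of_nonneg_of_le (fun k => by positivity) (fun k => ?_)
    (summable_prod3.mul_left (2^6 * (D0 + D7)))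
  have h0 := h0 k
  have h7 := h7 k
  set r := ‖k‖
  have hr : 0 ≤ r := norm_nonneg _
  have hki : ∀ i, 1 + (k i : ℝ)^2 ≤ (1 + r)^2 := by
    intro i
    have : |(k i : ℝ)| ≤ r := by
      have := norm_le_pi_norm k i
      rwa [Int.norm_eq_abs] at this
    have := sq_le_sq' (by linarith [abs_nonneg (k i : ℝ)]) this
    rw [sq_abs] at this
    nlinarith
  have hprod : ∏ i, (1 + (k i : ℝ)^2) ≤ (1+r)^6 := by
    calc _ ≤ ∏ i : Fin 3, (1 + r)^2 := Finset.prod_le_prod (fun i _ => by positivity) fun i _ => hki i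
      _ = _ := by simp; ring
  rw [Finset.prod_inv_distrib, ← div_eq_mul_inv, le_div_iff₀ (Finset.prod_pos fun i _ => by positivity)]
  have hp7 : (1 + r)^7 ≤ 2^6 * (1 + r^7) := by
    have := add_pow_le (zero_le_one) hr 7
    simpa using this
  calc _ ≤ (1 + r) * ‖fCoeff c k‖ * (1+r)^6 := by gcongr
    _ = (1+r)^7 * ‖fCoeff c k‖ := by ring
    _ ≤ 2^6 * (1 + r^7) * ‖fCoeff c k‖ := by gcongr
    _ = 2^6 * (r^0 * ‖fCoeff c k‖ + r^7 * ‖fCoeff c k‖) := by ring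
    _ ≤ _ := by gcongr

lemma mFourier_eq (k : Fin 3 → ℤ) (x : Td 3) :
    UnitAddTorus.mFourier k (fun i => (x i : UnitAddCircle)) = eK k x := by
  simp only [UnitAddTorus.mFourier, ContinuousMap.coe_mk, fourier_coe_apply, eK, ← Complex.exp_sum]
  congr 1
  rw [Finset.mul_sum]
  apply Finset.sum_congr rfl; intro i _
  simp; ring

lemma inversion (c : Td 3 → ℝ) (hc : ContDiff ℝ (⊤ : ℕ∞) c) (hp : TPer c) (x : Td 3) :
    HasSum (fun k : Fin 3 → ℤ => fCoeff c k * eK k x) (c x : ℂ) := by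
  have hq : IsOpenQuotientMap (Pi.map (fun (_ : Fin 3) (t : ℝ) => (t : UnitAddCircle))) :=
    IsOpenQuotientMap.piMap fun i => QuotientAddGroup.isOpenQuotientMap_mk
  let g : UnitAddTorus (Fin 3) → ℂ := fun y => (c (Function.surjInv hq.surjective y) : ℂ)
  have hg : ∀ y : Td 3, g (fun i => (y i : UnitAddCircle)) = (c y : ℂ) := by
    intro y
    have h := Function.surjInv_eq hq.surjective (fun i => (y i : UnitAddCircle))
    set z := Function.surjInv hq.surjective (fun i => (y i : UnitAddCircle)) with hz
    have : ∀ i, ∃ n : ℤ, z i = y i + n := by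
      intro i
      have hi := congrFun h i
      simp only [Pi.map_apply] at hi
      have h0 : ((z i - y i : ℝ) : AddCircle (1:ℝ)) = 0 := by
        rw [AddCircle.coe_sub]; exact sub_eq_zero.2 hi
      obtain ⟨n, hn⟩ := (AddCircle.coe_eq_zero_iff (1:ℝ)).1 h0
      refine ⟨n, ?_⟩
      simp at hn; linarith
    choose n hn using this
    have hzy : z = fun i => y i + n i := funext hn
    show (c z : ℂ) = c y
    rw [hzy, hp]
  have hgc : Continuous g := by
    rw [hq.isQuotientMap.continuous_iff]
    have : g ∘ (Pi.map (fun (_ : Fin 3) (t : ℝ) => (t : UnitAddCircle))) = fun y => (c y : ℂ) := by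
      ext y; exact hg y
    rw [this]; exact Complex.continuous_ofReal.comp hc.continuous
  let G : C(UnitAddTorus (Fin 3), ℂ) := ⟨g, hgc⟩
  have hco : ∀ k, UnitAddTorus.mFourierCoeff G k = fCoeff c k := by
    intro k
    rw [UnitAddTorus.mFourierCoeff_eq_integral _ _ 0, fCoeff_eq, cF]
    have : {x : Fin 3 → ℝ | ∀ i, x i ∈ Set.Ioc ((0 : Fin 3 → ℝ) i) ((0 : Fin 3 → ℝ) i + 1)} = box 3 := by
      ext y; simp [box, Set.mem_pi]
    rw [this]
    congr 1; ext y
    rw [mFourier_eq, smul_eq_mul, mul_comm]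
    congr 1
    exact hg y
  have hs : Summable (UnitAddTorus.mFourierCoeff G) := by
    rw [funext hco]
    apply Summable.of_norm
    refine Summable.of_nonneg_of_le (fun k => norm_nonneg _) (fun k => ?_) (summable_coeff c hc hp)
    nlinarith [norm_nonneg k, norm_nonneg (fCoeff c k), mul_nonneg (norm_nonneg k) (norm_nonneg (fCoeff c k))]
  have := UnitAddTorus.hasSum_mFourier_series_apply_of_summable hs (fun i => (x i : UnitAddCircle))
  simp only [hco, mFourier_eq, smul_eq_mul] at this
  have h2 : G (fun i => (x i : UnitAddCircle)) = (c x : ℂ) := hg x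
  rwa [h2] at this

/-- frequency cube -/
def cube (N : ℕ) : Finset (Fin 3 → ℤ) := Fintype.piFinset fun _ => Finset.Icc (-(N:ℤ)) N

lemma mem_cube (N : ℕ) (k : Fin 3 → ℤ) : k ∈ cube N ↔ ∀ i, |k i| ≤ N := by
  simp [cube, Fintype.mem_piFinset, abs_le]

def ph (φ : Td 3 → ℝ) (l : ℕ) (k : Fin 3 → ℤ) : ℝ := φ (fun i => (k i : ℝ) / 2 ^ l)

def ch (χ : Td 3 → ℝ) (k : Fin 3 → ℤ) : ℝ := χ (fun i => (k i : ℝ))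

lemma abs_le_eN (ξ : Td 3) (i : Fin 3) : |ξ i| ≤ eN ξ := by
  apply Real.abs_le_sqrt
  exact Finset.single_le_sum (f := fun i => (ξ i)^2) (fun i _ => sq_nonneg _) (Finset.mem_univ i)

lemma eN_le (ξ : Td 3) (r : ℝ) (hr : 0 ≤ r) (h : ∀ i, |ξ i| ≤ r) : eN ξ ≤ 2 * r := by
  apply Real.sqrt_le_iff.2 ⟨by positivity, ?_⟩
  have : ∀ i, (ξ i)^2 ≤ r^2 := fun i => sq_le_sq' (by linarith [(abs_le.1 (h i)).1]) (abs_le.1 (h i)).2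
  rw [Fin.sum_univ_three]
  nlinarith [this 0, this 1, this 2, sq_nonneg r]

lemma int_abs_le_norm (k : Fin 3 → ℤ) (i : Fin 3) : |(k i : ℝ)| ≤ ‖k‖ := by
  have := norm_le_pi_norm k i
  rwa [Int.norm_eq_abs] at this

lemma ph_ne {χ φ : Td 3 → ℝ} (h : LPpair χ φ) (l : ℕ) (k : Fin 3 → ℤ) (hk : ph φ l k ≠ 0) :
    (2:ℝ)^l ≤ 3 * ‖k‖ ∧ k ∈ cube (3 * 2^l) := by
  obtain ⟨h1, h2⟩ := h.2.2.1 _ hk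
  have hp : (0:ℝ) < 2^l := by positivity
  constructor
  · have := eN_le (fun i => (k i : ℝ) / 2 ^ l) (‖k‖ / 2^l) (by positivity) (fun i => by
      rw [abs_div, abs_of_pos hp]; gcongr; exact int_abs_le_norm k i)
    have h3 := h1.trans this
    rw [mul_div_assoc', le_div_iff₀ hp] at h3
    linarith
  · rw [mem_cube]; intro i
    have h3 := (abs_le_eN _ i).trans h2
    rw [abs_div, abs_of_pos hp, div_le_iff₀ hp] at h3
    have : |(k i : ℝ)| ≤ 3 * 2^l := by linarith
    exact_mod_cast this

lemma ch_ne {χ φ : Td 3 → ℝ} (h : LPpair χ φ) (k : Fin 3 → ℤ) (hk : ch χ k ≠ 0) :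
    k ∈ cube 3 := by
  have h2 := h.2.2.2.1 _ hk
  rw [mem_cube]; intro i
  have h3 := (abs_le_eN _ i).trans h2
  have : |(k i : ℝ)| ≤ 3 := by linarith
  exact_mod_cast this

lemma bdd_of_supp (ψ : Td 3 → ℝ) (hc : Continuous ψ) (hs : ∀ ξ, ψ ξ ≠ 0 → eN ξ ≤ 3) :
    ∃ M > 0, ∀ ξ, |ψ ξ| ≤ M := by
  obtain ⟨M, hM⟩ := (isCompact_closedBall (0 : Td 3) 3).exists_bound_of_continuousOn hc.continuousOn
  refine ⟨max M 1, by positivity, fun ξ => ?_⟩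
  by_cases h : ψ ξ = 0
  · rw [h, abs_zero]; positivity
  · have : ξ ∈ Metric.closedBall (0 : Td 3) 3 := by
      rw [mem_closedBall_zero_iff, pi_norm_le_iff_of_nonneg (by norm_num)]
      intro i
      exact (abs_le_eN ξ i).trans (hs ξ h)
    exact (hM ξ this).trans (le_max_left _ _)

lemma cube_mono {N N' : ℕ} (h : N ≤ N') {k : Fin 3 → ℤ} (hk : k ∈ cube N) : k ∈ cube N' := by
  rw [mem_cube] at *
  intro i; exact (hk i).trans (by exact_mod_cast h)

lemma LP_nat {χ φ : Td 3 → ℝ} (h : LPpair χ φ) (l N : ℕ) (hN : 3 * 2^l ≤ N) (f : Td 3 → ℝ)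
    (x : Td 3) : LPblock χ φ (l : ℤ) f x = trig (cube N) (fun k => (ph φ l k : ℂ) * fCoeff f k) x := by
  have : ((l : ℤ) = -1) = False := by simp
  simp only [LPblock, this, if_false, FMul, zpow_natCast, trig]
  rw [tsum_eq_sum (s := cube N)]
  · rfl
  · intro k hk
    have : ph φ l k = 0 := by
      by_contra h0
      exact hk (cube_mono hN (ph_ne h l k h0).2)
    simp only [ph] at this
    simp [this]

lemma LP_neg {χ φ : Td 3 → ℝ} (h : LPpair χ φ) (N : ℕ) (hN : 3 ≤ N) (f : Td 3 → ℝ)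
    (x : Td 3) : LPblock χ φ (-1) f x = trig (cube N) (fun k => (ch χ k : ℂ) * fCoeff f k) x := by
  simp only [LPblock, if_true, FMul, trig]
  rw [tsum_eq_sum (s := cube N)]
  · rfl
  · intro k hk
    have : ch χ k = 0 := by
      by_contra h0
      exact hk (cube_mono hN (ch_ne h k h0))
    simp only [ch] at this
    simp [this]

lemma trig_bound (N : ℕ) (m : (Fin 3 → ℤ) → ℝ) (c : Td 3 → ℝ) (hc : ContDiff ℝ (⊤ : ℕ∞) c)
    (hp : TPer c) (M : ℝ) (hm : ∀ k, |m k| ≤ M * (1 + ‖k‖)) (x : Td 3) :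
    ‖trig (cube N) (fun k => (m k : ℂ) * fCoeff c k) x‖
      ≤ M * ∑' k : Fin 3 → ℤ, (1 + ‖k‖) * ‖fCoeff c k‖ := by
  have hM : 0 ≤ M := by
    have := (abs_nonneg _).trans (hm 0); simpa using this
  calc _ ≤ ∑ k ∈ cube N, M * ((1 + ‖k‖) * ‖fCoeff c k‖) := by
        refine (norm_sum_le _ _).trans (Finset.sum_le_sum fun k _ => ?_)
        rw [norm_mul, norm_mul, eK_norm, mul_one, Complex.norm_real, Real.norm_eq_abs, ← mul_assoc]
        gcongr; exact hm k
    _ ≤ _ := by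
        rw [← Finset.mul_sum]; gcongr
        exact (summable_coeff c hc hp).sum_le_tsum _ (fun k _ => by positivity)

lemma holder_bdd {χ φ : Td 3 → ℝ} (h : LPpair χ φ) (α : ℝ) (hα : 0 < α) (hα1 : α < 1)
    (c : Td 3 → ℝ) (hc : ContDiff ℝ (⊤ : ℕ∞) c) (hp : TPer c) :
    ∃ K : ℝ, ∀ j : LPidx, ∀ x, (2:ℝ) ^ ((j.1 : ℝ) * α) * ‖LPblock χ φ j.1 c x‖ ≤ K := by
  obtain ⟨M, hM0, hM⟩ := bdd_of_supp φ h.2.1.continuous (fun ξ hξ => by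
    linarith [(h.2.2.1 ξ hξ).2])
  obtain ⟨M', hM0', hM'⟩ := bdd_of_supp χ h.1.continuous (fun ξ hξ => by
    linarith [(h.2.2.2.1 ξ hξ)])
  set Z := ∑' k : Fin 3 → ℤ, (1 + ‖k‖) * ‖fCoeff c k‖ with hZ
  have hZ0 : 0 ≤ Z := tsum_nonneg fun k => by positivity
  refine ⟨M' * Z + 3 * M * Z, fun j x => ?_⟩
  obtain ⟨j, hj⟩ := j
  rcases eq_or_lt_of_le hj with rfl | hj'
  · rw [LP_neg h 3 le_rfl]
    have h1 := trig_bound 3 (ch χ) c hc hp M' (fun k => (hM' _).trans (by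
      nlinarith [norm_nonneg k])) x
    have h2 : (2:ℝ) ^ (((-1 : ℤ) : ℝ) * α) ≤ 1 :=
      Real.rpow_le_one_of_one_le_of_nonpos (by norm_num) (by push_cast; linarith)
    have := mul_le_mul h2 h1 (norm_nonneg _) zero_le_one
    have : 0 ≤ 3 * M * Z := by positivity
    simp only at *
    linarith
  · obtain ⟨l, rfl⟩ : ∃ l : ℕ, j = l := ⟨j.toNat, by omega⟩
    simp only
    have h1 := trig_bound (3 * 2^l) (fun k => 2^l * ph φ l k) c hc hp (3 * M) (fun k => by
      rw [abs_mul, abs_of_pos (by positivity : (0:ℝ) < 2^l)]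
      by_cases h0 : ph φ l k = 0
      · rw [h0, abs_zero, mul_zero]; positivity
      · calc _ ≤ (3 * ‖k‖) * M := mul_le_mul (ph_ne h l k h0).1 (hM _) (abs_nonneg _) (by positivity)
          _ ≤ _ := by nlinarith [norm_nonneg k]) x
    rw [LP_nat h l _ le_rfl]
    have e : trig (cube (3 * 2^l)) (fun k => ((2^l * ph φ l k : ℝ) : ℂ) * fCoeff c k) x
        = 2^l * trig (cube (3 * 2^l)) (fun k => (ph φ l k : ℂ) * fCoeff c k) x := by
      simp only [trig, Finset.mul_sum]
      apply Finset.sum_congr rfl; intro k _; push_cast; ring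
    rw [e, norm_mul, norm_pow, Complex.norm_ofNat] at h1
    have h2 : (2:ℝ) ^ (((l : ℤ) : ℝ) * α) ≤ 2^l := by
      rw [← Real.rpow_natCast]
      apply Real.rpow_le_rpow_of_exponent_le (by norm_num)
      push_cast
      nlinarith [(Nat.cast_nonneg l : (0:ℝ) ≤ l)]
    have h3 : 0 ≤ M' * Z := by positivity
    calc _ ≤ 2^l * ‖trig (cube (3 * 2^l)) (fun k => (ph φ l k : ℂ) * fCoeff c k) x‖ := by gcongr
      _ ≤ 3 * M * Z := h1
      _ ≤ _ := by linarith

lemma holder_ge {χ φ : Td 3 → ℝ} (h : LPpair χ φ) (α : ℝ) (hα : 0 < α) (hα1 : α < 1)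
    (c : Td 3 → ℝ) (hc : ContDiff ℝ (⊤ : ℕ∞) c) (hp : TPer c) (j : LPidx) (x : Td 3) :
    (2:ℝ) ^ ((j.1 : ℝ) * α) * ‖LPblock χ φ j.1 c x‖ ≤ holderN χ φ α c := by
  obtain ⟨K, hK⟩ := holder_bdd h α hα hα1 c hc hp
  have hb : ∀ j : LPidx, BddAbove (Set.range fun x => ‖LPblock χ φ j.1 c x‖) := by
    intro j
    refine ⟨K / (2:ℝ) ^ ((j.1 : ℝ) * α), ?_⟩
    rintro _ ⟨x, rfl⟩
    rw [le_div_iff₀ (by positivity), mul_comm]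
    exact hK j x
  have hb2 : BddAbove (Set.range fun j : LPidx =>
      (2:ℝ) ^ ((j.1 : ℝ) * α) * ⨆ x : Td 3, ‖LPblock χ φ j.1 c x‖) := by
    refine ⟨K, ?_⟩
    rintro _ ⟨j, rfl⟩
    simp only
    rw [← le_div_iff₀' (by positivity)]
    apply ciSup_le
    intro x
    rw [le_div_iff₀' (by positivity)]
    exact hK j x
  refine le_trans ?_ (le_ciSup hb2 j)
  gcongr
  exact le_ciSup (hb j) x

lemma holder_nonneg {χ φ : Td 3 → ℝ} (h : LPpair χ φ) (α : ℝ) (hα : 0 < α) (hα1 : α < 1)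
    (c : Td 3 → ℝ) (hc : ContDiff ℝ (⊤ : ℕ∞) c) (hp : TPer c) : 0 ≤ holderN χ φ α c :=
  le_trans (by positivity) (holder_ge h α hα hα1 c hc hp ⟨-1, le_rfl⟩ 0)

lemma block_nat {χ φ : Td 3 → ℝ} (h : LPpair χ φ) (α : ℝ) (hα : 0 < α) (hα1 : α < 1)
    (c : Td 3 → ℝ) (hc : ContDiff ℝ (⊤ : ℕ∞) c) (hp : TPer c) (l : ℕ) (x : Td 3) :
    ‖LPblock χ φ (l : ℤ) c x‖ ≤ ((2:ℝ) ^ (-α)) ^ l * holderN χ φ α c := by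
  have := holder_ge h α hα hα1 c hc hp ⟨(l : ℤ), by omega⟩ x
  simp only at this
  have e : ((2:ℝ) ^ (-α)) ^ l = ((2:ℝ) ^ (((l:ℤ) : ℝ) * α))⁻¹ := by
    rw [← Real.rpow_natCast, ← Real.rpow_mul (by norm_num), ← Real.rpow_neg (by norm_num)]
    congr 1; push_cast; ring
  rw [e, le_inv_mul_iff₀ (by positivity)]
  exact this

lemma block_neg {χ φ : Td 3 → ℝ} (h : LPpair χ φ) (α : ℝ) (hα : 0 < α) (hα1 : α < 1)
    (c : Td 3 → ℝ) (hc : ContDiff ℝ (⊤ : ℕ∞) c) (hp : TPer c) (x : Td 3) :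
    ‖LPblock χ φ (-1) c x‖ ≤ 2 * holderN χ φ α c := by
  have := holder_ge h α hα hα1 c hc hp ⟨-1, le_rfl⟩ x
  simp only at this
  have e : (2:ℝ)⁻¹ ≤ (2:ℝ) ^ (((-1:ℤ) : ℝ) * α) := by
    rw [← Real.rpow_neg_one]
    apply Real.rpow_le_rpow_of_exponent_le (by norm_num)
    push_cast; linarith
  have h2 := mul_le_mul_of_nonneg_right e (norm_nonneg (LPblock χ φ (-1) c x))
  have h3 := h2.trans this
  linarith

/-- partial sum symbol -/
def chs (χ φ : Td 3 → ℝ) (J : ℕ) (k : Fin 3 → ℤ) : ℝ := ch χ k + ∑ l ∈ Finset.range J, ph φ l k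

lemma chs_eventually {χ φ : Td 3 → ℝ} (h : LPpair χ φ) (k : Fin 3 → ℤ) :
    ∀ᶠ J : ℕ in Filter.atTop, chs χ φ J k = 1 := by
  filter_upwards [Filter.eventually_ge_atTop (⌈3 * ‖k‖⌉₊)] with J hJ
  have h1 := h.2.2.2.2 (fun i => (k i : ℝ))
  rw [tsum_eq_sum (s := Finset.range J)] at h1
  · exact h1
  · intro l hl
    by_contra h0
    have h2 := (ph_ne h l k h0).1
    simp only [Finset.mem_range, not_lt] at hl
    have h3 : (l : ℝ) < 2^l := by exact_mod_cast Nat.lt_two_pow_self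
    have h4 : 3 * ‖k‖ ≤ l := (Nat.le_ceil _).trans (by exact_mod_cast hJ.trans hl)
    linarith

lemma chs_bdd {χ φ : Td 3 → ℝ} (h : LPpair χ φ) : ∃ M, ∀ J k, |chs χ φ J k| ≤ M * (1 + ‖k‖) := by
  obtain ⟨M, hM0, hM⟩ := bdd_of_supp φ h.2.1.continuous (fun ξ hξ => by
    linarith [(h.2.2.1 ξ hξ).2])
  obtain ⟨M', hM0', hM'⟩ := bdd_of_supp χ h.1.continuous (fun ξ hξ => by
    linarith [(h.2.2.2.1 ξ hξ)])
  refine ⟨M' + 4 * M, fun J k => ?_⟩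
  have h1 : |∑ l ∈ Finset.range J, ph φ l k| ≤ M * (3 * ‖k‖ + 1) := by
    calc _ ≤ ∑ l ∈ Finset.range J, |ph φ l k| := Finset.abs_sum_le_sum_abs _ _
      _ ≤ ∑ l ∈ Finset.range J, (if l < ⌈3 * ‖k‖⌉₊ then M else 0) := by
        apply Finset.sum_le_sum; intro l _
        split_ifs with hl
        · exact hM _
        · by_contra h0
          have h0' : ph φ l k ≠ 0 := by intro h1; rw [h1, abs_zero] at h0; exact h0 le_rfl
          have h2 := (ph_ne h l k h0').1
          have h3 : (l : ℝ) < 2^l := by exact_mod_cast Nat.lt_two_pow_self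
          have h4 : 3 * ‖k‖ ≤ l := (Nat.le_ceil _).trans (by exact_mod_cast not_lt.1 hl)
          linarith
      _ = ((Finset.range J).filter (fun l => l < ⌈3 * ‖k‖⌉₊)).card * M := by
        rw [Finset.sum_ite, Finset.sum_const_zero, add_zero, Finset.sum_const, nsmul_eq_mul]
      _ ≤ (⌈3 * ‖k‖⌉₊ : ℝ) * M := by
        gcongr
        calc _ ≤ (Finset.range ⌈3 * ‖k‖⌉₊).card := by
              apply Finset.card_le_card; intro l; simp
          _ = _ := by simp
      _ ≤ _ := by
        rw [mul_comm]; gcongr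
        exact (Nat.ceil_lt_add_one (by positivity)).le
  have h2 := hM' (fun i => (k i : ℝ))
  have h3 := abs_add_le (ch χ k) (∑ l ∈ Finset.range J, ph φ l k)
  have hk := norm_nonneg k
  have h4 : |ch χ k| ≤ M' := h2
  unfold chs
  nlinarith [mul_nonneg hM0'.le hk, mul_nonneg hM0.le hk]

/-- partial Littlewood–Paley sum -/
lemma partial_eq {χ φ : Td 3 → ℝ} (h : LPpair χ φ) (c : Td 3 → ℝ) (J : ℕ) (x : Td 3) :
    trig (cube (3 * 2^J)) (fun k => (chs χ φ J k : ℂ) * fCoeff c k) x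
      = LPblock χ φ (-1) c x + ∑ l ∈ Finset.range J, LPblock χ φ (l : ℤ) c x := by
  rw [LP_neg h (3 * 2^J) (by have := Nat.one_le_two_pow (n := J); omega)]
  have : ∀ l ∈ Finset.range J, LPblock χ φ (l : ℤ) c x =
      trig (cube (3 * 2^J)) (fun k => (ph φ l k : ℂ) * fCoeff c k) x := by
    intro l hl
    apply LP_nat h
    have := Nat.pow_le_pow_right (n := 2) (by norm_num) (Finset.mem_range.1 hl).le
    omega
  rw [Finset.sum_congr rfl this]
  simp only [trig]
  rw [Finset.sum_comm, ← Finset.sum_add_distrib]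
  apply Finset.sum_congr rfl; intro k _
  simp only [chs]; push_cast
  rw [add_mul, add_mul, Finset.sum_mul, Finset.sum_mul]

lemma chs_ne {χ φ : Td 3 → ℝ} (h : LPpair χ φ) (J : ℕ) (k : Fin 3 → ℤ) (hk : k ∉ cube (3 * 2^J)) :
    chs χ φ J k = 0 := by
  have h1 : ch χ k = 0 := by
    by_contra h0
    exact hk (cube_mono (by have := Nat.one_le_two_pow (n := J); omega) (ch_ne h k h0))
  have h2 : ∀ l ∈ Finset.range J, ph φ l k = 0 := by
    intro l hl
    by_contra h0
    have := Nat.pow_le_pow_right (n := 2) (by norm_num) (Finset.mem_range.1 hl).le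
    exact hk (cube_mono (by omega) (ph_ne h l k h0).2)
  rw [chs, h1, Finset.sum_eq_zero h2, add_zero]

lemma partial_tendsto {χ φ : Td 3 → ℝ} (h : LPpair χ φ) (c : Td 3 → ℝ)
    (hc : ContDiff ℝ (⊤ : ℕ∞) c) (hp : TPer c) (x : Td 3) :
    Filter.Tendsto (fun J : ℕ => trig (cube (3 * 2^J)) (fun k => (chs χ φ J k : ℂ) * fCoeff c k) x)
      Filter.atTop (nhds (c x : ℂ)) := by
  obtain ⟨M, hM⟩ := chs_bdd h
  have e : ∀ J : ℕ, trig (cube (3 * 2^J)) (fun k => (chs χ φ J k : ℂ) * fCoeff c k) x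
      = ∑' k, (chs χ φ J k : ℂ) * fCoeff c k * eK k x := by
    intro J
    rw [tsum_eq_sum (s := cube (3 * 2^J))]
    · rfl
    · intro k hk; rw [chs_ne h J k hk]; simp
  simp only [e]
  rw [← (inversion c hc hp x).tsum_eq]
  refine tendsto_tsum_of_dominated_convergence ((summable_coeff c hc hp).mul_left M) ?_ ?_
  · intro k
    apply Filter.Tendsto.congr' _ tendsto_const_nhds
    filter_upwards [chs_eventually h k] with J hJ
    rw [hJ]; simp
  · filter_upwards with J k
    rw [norm_mul, norm_mul, eK_norm, mul_one, Complex.norm_real, Real.norm_eq_abs, ← mul_assoc]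
    gcongr; exact hM J k

lemma high_bound {χ φ : Td 3 → ℝ} (h : LPpair χ φ) (α : ℝ) (hα : 0 < α) (hα1 : α < 1)
    (c : Td 3 → ℝ) (hc : ContDiff ℝ (⊤ : ℕ∞) c) (hp : TPer c) (j : ℕ) (x : Td 3) :
    ‖(c x : ℂ) - trig (cube (3 * 2^j)) (fun k => (chs χ φ j k : ℂ) * fCoeff c k) x‖
      ≤ ((2:ℝ) ^ (-α)) ^ j * ((1 - (2:ℝ) ^ (-α))⁻¹ * holderN χ φ α c) := by
  set q := (2:ℝ) ^ (-α) with hq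
  have hq0 : 0 < q := by positivity
  have hq1 : q < 1 := Real.rpow_lt_one_of_one_lt_of_neg (by norm_num) (by linarith)
  have hH := holder_nonneg h α hα hα1 c hc hp
  refine le_of_tendsto ((partial_tendsto h c hc hp x).sub_const _).norm ?_
  filter_upwards [Filter.eventually_ge_atTop j] with J hJ
  rw [partial_eq h, partial_eq h, add_sub_add_left_eq_sub, ← Finset.sum_Ico_eq_sub _ hJ]
  calc _ ≤ ∑ l ∈ Finset.Ico j J, q ^ l * holderN χ φ α c :=
        (norm_sum_le _ _).trans (Finset.sum_le_sum fun l _ => block_nat h α hα hα1 c hc hp l x)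
    _ = (∑ l ∈ Finset.Ico j J, q ^ l) * holderN χ φ α c := by rw [Finset.sum_mul]
    _ ≤ (q ^ j / (1 - q)) * holderN χ φ α c := by
        gcongr
        exact geom_sum_Ico_le_of_lt_one hq0.le hq1
    _ = _ := by rw [div_eq_mul_inv]; ring

lemma low_bound {χ φ : Td 3 → ℝ} (h : LPpair χ φ) (α : ℝ) (hα : 0 < α) (hα1 : α < 1)
    (c : Td 3 → ℝ) (hc : ContDiff ℝ (⊤ : ℕ∞) c) (hp : TPer c) (j : ℕ) (i : Fin 3) (x : Td 3) :
    ‖trig (cube (3 * 2^j)) (fun k => (k i : ℂ) * ((chs χ φ j k : ℂ) * fCoeff c k)) x‖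
      ≤ ((2:ℝ) ^ (1-α)) ^ j * ((12 + 6 * ((2:ℝ) ^ (1-α) - 1)⁻¹) * holderN χ φ α c) := by
  set p := (2:ℝ) ^ (1-α) with hpd
  set q := (2:ℝ) ^ (-α) with hq
  have hpq : p = 2 * q := by
    rw [hpd, hq, sub_eq_add_neg, Real.rpow_add (by norm_num), Real.rpow_one]
  have hp1 : 1 < p := Real.one_lt_rpow (by norm_num) (by linarith)
  have hH := holder_nonneg h α hα hα1 c hc hp
  set H := holderN χ φ α c
  set S := cube (3 * 2^j)
  have e : trig S (fun k => (k i : ℂ) * ((chs χ φ j k : ℂ) * fCoeff c k)) x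
     = trig S (fun k => (k i : ℂ) * ((ch χ k : ℂ) * fCoeff c k)) x
       + ∑ l ∈ Finset.range j, trig S (fun k => (k i : ℂ) * ((ph φ l k : ℂ) * fCoeff c k)) x := by
    simp only [trig]
    rw [Finset.sum_comm, ← Finset.sum_add_distrib]
    apply Finset.sum_congr rfl; intro k _
    simp only [chs]; push_cast
    rw [add_mul, mul_add, add_mul, Finset.sum_mul, Finset.mul_sum, Finset.sum_mul]
  have h1 : ‖trig S (fun k => (k i : ℂ) * ((ch χ k : ℂ) * fCoeff c k)) x‖ ≤ 2 * (3:ℕ) * (2 * H) := by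
    apply bern_ineq S (fun k => (ch χ k : ℂ) * fCoeff c k) i 3 (by norm_num)
    · intro k _ hk
      have : ch χ k ≠ 0 := by intro h0; apply hk; simp [h0]
      exact (mem_cube _ _).1 (ch_ne h k this) i
    · intro y
      rw [← LP_neg h (3 * 2^j) (by have := Nat.one_le_two_pow (n := j); omega)]
      exact block_neg h α hα hα1 c hc hp y
  have h2 : ∀ l ∈ Finset.range j, ‖trig S (fun k => (k i : ℂ) * ((ph φ l k : ℂ) * fCoeff c k)) x‖
      ≤ p ^ l * (6 * H) := by
    intro l hl
    have hl' := Nat.pow_le_pow_right (n := 2) (by norm_num) (Finset.mem_range.1 hl).le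
    have := bern_ineq S (fun k => (ph φ l k : ℂ) * fCoeff c k) i (3 * 2^l) (by positivity)
      (fun k _ hk => by
        have : ph φ l k ≠ 0 := by intro h0; apply hk; simp [h0]
        exact (mem_cube _ _).1 (ph_ne h l k this).2 i) (q ^ l * H)
      (fun y => by
        rw [← LP_nat h l (3 * 2^j) (by omega)]
        exact block_nat h α hα hα1 c hc hp l y) x
    refine this.trans (le_of_eq ?_)
    rw [hpq, mul_pow]; push_cast; ring
  rw [e]
  have hpj : 1 ≤ p ^ j := one_le_pow₀ hp1.le
  have hgeom : ∑ l ∈ Finset.range j, p ^ l ≤ p ^ j * (p - 1)⁻¹ := by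
    rw [geom_sum_eq hp1.ne', div_eq_mul_inv]
    have : 0 < p - 1 := by linarith
    gcongr; linarith
  calc _ ≤ 12 * H + ∑ l ∈ Finset.range j, p ^ l * (6 * H) := by
        refine (norm_add_le _ _).trans (add_le_add (h1.trans (by push_cast; linarith)) ?_)
        exact (norm_sum_le _ _).trans (Finset.sum_le_sum h2)
    _ = 12 * H + (∑ l ∈ Finset.range j, p ^ l) * (6 * H) := by rw [Finset.sum_mul]
    _ ≤ p ^ j * (12 * H) + (p ^ j * (p - 1)⁻¹) * (6 * H) := by
        have h5 : 12 * H ≤ p ^ j * (12 * H) := le_mul_of_one_le_left (by positivity) hpj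
        exact add_le_add h5 (mul_le_mul_of_nonneg_right hgeom (by positivity))
    _ = _ := by ring

lemma coord_contDiff {u : Td 3 → Td 3} (hu : ContDiff ℝ (⊤ : ℕ∞) u) (i : Fin 3) :
    ContDiff ℝ (⊤ : ℕ∞) (fun x => u x i) := (contDiff_apply ℝ ℝ i).comp hu

lemma cF_sum (g : Fin 3 → Td 3 → ℂ) (hg : ∀ i, Continuous (g i)) (k : Fin 3 → ℤ) :
    cF (fun x => ∑ i, g i x) k = ∑ i, cF (g i) k := by
  simp only [cF, Finset.sum_mul]
  rw [integral_finsetSum]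
  intro i _
  exact box_int ((hg i).mul (eK_cont _))

lemma fCoeff_sum (g : Fin 3 → Td 3 → ℝ) (hg : ∀ i, Continuous (g i)) (k : Fin 3 → ℤ) :
    fCoeff (fun x => ∑ i, g i x) k = ∑ i, fCoeff (g i) k := by
  simp only [fCoeff_eq, Complex.ofReal_sum]
  exact cF_sum (fun i x => (g i x : ℂ)) (fun i => Complex.continuous_ofReal.comp (hg i)) k

lemma pd_cont {f : Td 3 → ℝ} (hf : ContDiff ℝ (⊤ : ℕ∞) f) (i : Fin 3) : Continuous (pd i f) := by
  have : Continuous (fderiv ℝ f) := hf.continuous_fderiv (by simp)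
  exact this.clm_apply continuous_const

lemma div_fourier {u : Td 3 → Td 3} (hu : ContDiff ℝ (⊤ : ℕ∞) u) (hp : ∀ i, TPer fun x => u x i)
    (hd : ∀ x, (∑ i, pd i (fun y => u y i) x) = 0) (n : Fin 3 → ℤ) :
    ∑ i, (n i : ℂ) * fCoeff (fun x => u x i) n = 0 := by
  have h1 := fCoeff_sum (fun i => pd i (fun y => u y i)) (fun i => pd_cont (coord_contDiff hu i) i) n
  simp only [hd] at h1
  have h2 : fCoeff (fun _ : Td 3 => (0:ℝ)) n = 0 := by simp [fCoeff]
  rw [h2] at h1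
  have h3 : ∀ i, fCoeff (pd i (fun y => u y i)) n
      = 2 * Real.pi * Complex.I * ((n i : ℂ) * fCoeff (fun x => u x i) n) := by
    intro i
    rw [fCoeff_pd _ ((coord_contDiff hu i).of_le (by simp)) (hp i) i n]; ring
  simp only [h3, ← Finset.mul_sum] at h1
  exact (mul_eq_zero.1 h1.symm).resolve_left Complex.two_pi_I_ne_zero

lemma cF_mul_trig (v : Td 3 → ℝ) (hv : Continuous v) (S : Finset (Fin 3 → ℤ))
    (a : (Fin 3 → ℤ) → ℂ) (k : Fin 3 → ℤ) :
    cF (fun x => (v x : ℂ) * trig S a x) k = ∑ m ∈ S, a m * fCoeff v (k - m) := by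
  have e : ∀ x, (v x : ℂ) * trig S a x * eK (-k) x
      = ∑ m ∈ S, a m * ((v x : ℂ) * eK (-(k - m)) x) := by
    intro x
    rw [trig, Finset.mul_sum, Finset.sum_mul]
    apply Finset.sum_congr rfl; intro m _
    rw [show -(k - m) = m + -k by abel, eK_add]; ring
  simp only [cF, e, fCoeff_eq]
  rw [integral_finsetSum]
  · simp only [integral_const_mul]
  · intro m _
    exact box_int (continuous_const.mul ((Complex.continuous_ofReal.comp hv).mul (eK_cont _)))

lemma transport_fourier {u : Td 3 → Td 3} {c : Td 3 → ℝ} (hu : ContDiff ℝ (⊤ : ℕ∞) u)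
    (hp : ∀ i, TPer fun x => u x i)
    (hd : ∀ x, (∑ i, pd i (fun y => u y i) x) = 0)
    (hc : ContDiff ℝ (⊤ : ℕ∞) c) (hcp : TPer c) (k : Fin 3 → ℤ) :
    fCoeff (fun x => ∑ i, u x i * pd i c x) k
      = 2 * Real.pi * Complex.I * ∑ i, (k i : ℂ) * cF (fun x => (u x i : ℂ) * (c x : ℂ)) k := by
  have hs : ∀ i, ContDiff ℝ (⊤ : ℕ∞) (fun x => u x i * c x) := fun i => (coord_contDiff hu i).mul hc
  have h0 : (fun x => ∑ i, u x i * pd i c x) = fun x => ∑ i, pd i (fun y => u y i * c y) x := by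
    ext x
    have h1 : ∀ i, pd i (fun y => u y i * c y) x = u x i * pd i c x + c x * pd i (fun y => u y i) x := by
      intro i
      have d1 : DifferentiableAt ℝ (fun y => u y i) x := (coord_contDiff hu i).differentiable (by simp) x
      have d2 : DifferentiableAt ℝ c x := hc.differentiable (by simp) x
      simp only [pd]
      rw [fderiv_fun_mul d1 d2]
      simp
    simp only [h1, Finset.sum_add_distrib, ← Finset.mul_sum, hd, mul_zero, add_zero]
  rw [h0, fCoeff_sum (fun i => pd i (fun y => u y i * c y)) (fun i => pd_cont (hs i) i), Finset.mul_sum]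
  apply Finset.sum_congr rfl; intro i _
  have hper : TPer (fun y => u y i * c y) := by
    intro x m
    have e1 := hp i x m
    have e2 := hcp x m
    simp only at e1
    simp only [e1, e2]
  rw [fCoeff_pd _ ((hs i).of_le (by simp)) hper i k, fCoeff_eq]
  simp only [Complex.ofReal_mul]
  ring

lemma split_fourier {u : Td 3 → Td 3} {c : Td 3 → ℝ} (hu : ContDiff ℝ (⊤ : ℕ∞) u)
    (hp : ∀ i, TPer fun x => u x i)
    (hd : ∀ x, (∑ i, pd i (fun y => u y i) x) = 0)
    (hc : ContDiff ℝ (⊤ : ℕ∞) c) (S : Finset (Fin 3 → ℤ)) (a : (Fin 3 → ℤ) → ℂ) (k : Fin 3 → ℤ) :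
    ∑ i, (k i : ℂ) * cF (fun x => (u x i : ℂ) * (c x : ℂ)) k
      = ∑ i, (k i : ℂ) * cF (fun x => (u x i : ℂ) * ((c x : ℂ) - trig S a x)) k
        + cF (fun x => ∑ i, (u x i : ℂ) * trig S (fun m => (m i : ℂ) * a m) x) k := by
  have hui : ∀ i, Continuous (fun x => u x i) := fun i => (coord_contDiff hu i).continuous
  have huc : ∀ i, Continuous (fun x => (u x i : ℂ)) := fun i => Complex.continuous_ofReal.comp (hui i)
  have hcc : Continuous (fun x => (c x : ℂ)) := Complex.continuous_ofReal.comp hc.continuous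
  have h1 : ∀ i, cF (fun x => (u x i : ℂ) * ((c x : ℂ) - trig S a x)) k
      = cF (fun x => (u x i : ℂ) * (c x : ℂ)) k - ∑ m ∈ S, a m * fCoeff (fun x => u x i) (k - m) := by
    intro i
    rw [← cF_mul_trig _ (hui i)]
    simp only [cF, mul_sub, sub_mul]
    rw [integral_sub]
    · exact box_int (((huc i).mul hcc).mul (eK_cont _))
    · exact box_int (((huc i).mul (trig_cont _ _)).mul (eK_cont _))
  rw [cF_sum (fun i x => (u x i : ℂ) * trig S (fun m => (m i : ℂ) * a m) x)
    (fun i => (huc i).mul (trig_cont _ _))]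
  simp only [h1, fun i => cF_mul_trig _ (hui i) S (fun m => (m i : ℂ) * a m) k]
  have h2 : ∑ i, (k i : ℂ) * ∑ m ∈ S, a m * fCoeff (fun x => u x i) (k - m)
      = ∑ i, ∑ m ∈ S, (m i : ℂ) * a m * fCoeff (fun x => u x i) (k - m) := by
    rw [← sub_eq_zero, ← Finset.sum_sub_distrib]
    simp only [Finset.mul_sum, ← Finset.sum_sub_distrib]
    rw [Finset.sum_comm]
    apply Finset.sum_eq_zero; intro m _
    have := div_fourier hu hp hd (k - m)
    rw [← mul_zero (a m), ← this, Finset.mul_sum]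
    apply Finset.sum_congr rfl; intro i _
    simp only [Pi.sub_apply, Int.cast_sub]; ring
  simp only [mul_sub, Finset.sum_sub_distrib, h2]
  ring

lemma four_sq (K : ℝ) (k : Fin 3 → ℤ) (hk : ∀ i, |(k i : ℝ)| ≤ K) (X : Fin 3 → ℂ) (Y : ℂ) :
    ‖∑ i, (k i : ℂ) * X i + Y‖^2 ≤ 4 * (K^2 * ∑ i, ‖X i‖^2 + ‖Y‖^2) := by
  have hK : 0 ≤ K := (abs_nonneg _).trans (hk 0)
  have h1 : ‖∑ i, (k i : ℂ) * X i + Y‖ ≤ K * ‖X 0‖ + K * ‖X 1‖ + K * ‖X 2‖ + ‖Y‖ := by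
    have hi : ∀ i, ‖(k i : ℂ) * X i‖ ≤ K * ‖X i‖ := by
      intro i
      rw [norm_mul, Complex.norm_intCast]
      exact mul_le_mul_of_nonneg_right (hk i) (norm_nonneg _)
    refine (norm_add_le _ _).trans (add_le_add ?_ le_rfl)
    refine (norm_sum_le _ _).trans ?_
    rw [Fin.sum_univ_three]
    exact add_le_add (add_le_add (hi 0) (hi 1)) (hi 2)
  have h2 := pow_le_pow_left₀ (norm_nonneg _) h1 2
  refine h2.trans ?_
  rw [Fin.sum_univ_three]
  nlinarith [sq_nonneg (K * ‖X 0‖ - K * ‖X 1‖), sq_nonneg (K * ‖X 0‖ - K * ‖X 2‖),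
    sq_nonneg (K * ‖X 1‖ - K * ‖X 2‖), sq_nonneg (K * ‖X 0‖ - ‖Y‖), sq_nonneg (K * ‖X 1‖ - ‖Y‖),
    sq_nonneg (K * ‖X 2‖ - ‖Y‖)]

/-- the quadratic estimate for one block -/
lemma block_sq {χ φ : Td 3 → ℝ} (hLP : LPpair χ φ) (M : ℝ) (hM : ∀ ξ, |φ ξ| ≤ M)
    {u : Td 3 → Td 3} {c : Td 3 → ℝ} (hu : ContDiff ℝ (⊤ : ℕ∞) u)
    (hp : ∀ i, TPer fun x => u x i)
    (hd : ∀ x, (∑ i, pd i (fun y => u y i) x) = 0)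
    (hc : ContDiff ℝ (⊤ : ℕ∞) c) (hcp : TPer c) (j : ℕ) (a : (Fin 3 → ℤ) → ℂ) (A B : ℝ)
    (hA : ∀ x, ‖(c x : ℂ) - trig (cube (3 * 2^j)) a x‖ ≤ A)
    (hB : ∀ i x, ‖trig (cube (3 * 2^j)) (fun k => (k i : ℂ) * a k) x‖ ≤ B) :
    ∫ x in box 3, ‖LPblock χ φ (j : ℤ) (fun x => ∑ i, u x i * pd i c x) x‖^2
      ≤ (M * (2 * Real.pi))^2 * (4 * ((3 * 2^j)^2 * A^2 + 3 * B^2)) *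
        ∫ x in box 3, ∑ i, (u x i)^2 := by
  have hui : ∀ i, Continuous (fun x => u x i) := fun i => (coord_contDiff hu i).continuous
  have huc : ∀ i, Continuous (fun x => (u x i : ℂ)) := fun i => Complex.continuous_ofReal.comp (hui i)
  have hcc : Continuous (fun x => (c x : ℂ)) := Complex.continuous_ofReal.comp hc.continuous
  set S := cube (3 * 2^j) with hS
  set W := ∫ x in box 3, ∑ i, (u x i)^2 with hW
  have hWs : W = ∑ i, ∫ x in box 3, (u x i)^2 := by
    rw [hW, integral_finsetSum]
    intro i _; exact box_int ((hui i).pow 2)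
  set X : Fin 3 → (Fin 3 → ℤ) → ℂ := fun i k =>
    cF (fun x => (u x i : ℂ) * ((c x : ℂ) - trig S a x)) k with hX
  set Y : (Fin 3 → ℤ) → ℂ := fun k =>
    cF (fun x => ∑ i, (u x i : ℂ) * trig S (fun m => (m i : ℂ) * a m) x) k with hY
  have hXb : ∀ i, ∑ k ∈ S, ‖X i k‖^2 ≤ A^2 * ∫ x in box 3, (u x i)^2 := by
    intro i
    have hcont : Continuous (fun x => (u x i : ℂ) * ((c x : ℂ) - trig S a x)) :=
      (huc i).mul (hcc.sub (trig_cont _ _))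
    refine (bessel _ hcont S).trans ?_
    rw [← integral_const_mul]
    apply integral_mono (box_int (hcont.norm.pow 2)) (box_int (continuous_const.mul ((hui i).pow 2)))
    intro x
    change ‖(u x i : ℂ) * ((c x : ℂ) - trig S a x)‖^2 ≤ A^2 * (u x i)^2
    simp only [norm_mul, mul_pow, Complex.norm_real, Real.norm_eq_abs, sq_abs]
    rw [mul_comm]
    exact mul_le_mul_of_nonneg_right (pow_le_pow_left₀ (norm_nonneg _) (hA x) 2) (sq_nonneg _)
  have hYb : ∑ k ∈ S, ‖Y k‖^2 ≤ 3 * B^2 * W := by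
    have hcont : Continuous (fun x => ∑ i, (u x i : ℂ) * trig S (fun m => (m i : ℂ) * a m) x) :=
      continuous_finsetSum _ fun i _ => (huc i).mul (trig_cont _ _)
    refine (bessel _ hcont S).trans ?_
    rw [hW, ← integral_const_mul]
    apply integral_mono (box_int (hcont.norm.pow 2))
      (box_int (continuous_const.mul (continuous_finsetSum _ fun i _ => (hui i).pow 2)))
    intro x
    change ‖∑ i, (u x i : ℂ) * trig S (fun m => (m i : ℂ) * a m) x‖^2 ≤ 3 * B^2 * ∑ i, (u x i)^2
    have hi : ∀ i, ‖(u x i : ℂ) * trig S (fun m => (m i : ℂ) * a m) x‖ ≤ |u x i| * B := by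
      intro i
      rw [norm_mul, Complex.norm_real, Real.norm_eq_abs]
      exact mul_le_mul_of_nonneg_left (hB i x) (abs_nonneg _)
    have h1 : ‖∑ i, (u x i : ℂ) * trig S (fun m => (m i : ℂ) * a m) x‖
        ≤ (|u x 0| + |u x 1| + |u x 2|) * B := by
      refine (norm_sum_le _ _).trans ?_
      rw [Fin.sum_univ_three]
      linarith [hi 0, hi 1, hi 2]
    have h2 := pow_le_pow_left₀ (norm_nonneg _) h1 2
    refine h2.trans ?_
    simp only [Fin.sum_univ_three]
    rw [mul_pow, ← sq_abs (u x 0), ← sq_abs (u x 1), ← sq_abs (u x 2)]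
    have h3 : (|u x 0| + |u x 1| + |u x 2|)^2 ≤ 3 * (|u x 0|^2 + |u x 1|^2 + |u x 2|^2) := by
      nlinarith [sq_nonneg (|u x 0| - |u x 1|), sq_nonneg (|u x 0| - |u x 2|),
        sq_nonneg (|u x 1| - |u x 2|)]
    have := mul_le_mul_of_nonneg_right h3 (sq_nonneg B)
    linarith
  have hk : ∀ k ∈ S, ‖(ph φ j k : ℂ) * fCoeff (fun x => ∑ i, u x i * pd i c x) k‖^2
      ≤ (M * (2 * Real.pi))^2 * (4 * ((3 * 2^j)^2 * ∑ i, ‖X i k‖^2 + ‖Y k‖^2)) := by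
    intro k hkS
    rw [transport_fourier hu hp hd hc hcp, split_fourier hu hp hd hc S a]
    have e : ‖(2 * Real.pi * Complex.I : ℂ)‖ = 2 * Real.pi := by
      simp [abs_of_pos Real.pi_pos]
    rw [norm_mul, norm_mul, e, ← mul_assoc, mul_pow, Complex.norm_real, Real.norm_eq_abs]
    have hkb : ∀ i, |(k i : ℝ)| ≤ 3 * 2^j := by
      intro i
      have := (mem_cube _ _).1 hkS i
      exact_mod_cast this
    have := four_sq (3 * 2^j) k hkb (fun i => X i k) (Y k)
    apply mul_le_mul _ this (by positivity) (by positivity)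
    apply pow_le_pow_left₀ (by positivity)
    exact mul_le_mul_of_nonneg_right (hM _) (by positivity)
  simp only [fun x => LP_nat hLP j (3 * 2^j) le_rfl (fun x => ∑ i, u x i * pd i c x) x]
  rw [parseval]
  refine (Finset.sum_le_sum hk).trans ?_
  rw [← Finset.mul_sum, ← Finset.mul_sum, Finset.sum_add_distrib, ← Finset.mul_sum, Finset.sum_comm,
    mul_assoc]
  apply mul_le_mul_of_nonneg_left _ (sq_nonneg _)
  have h5 : ∑ i, ∑ k ∈ S, ‖X i k‖^2 ≤ A^2 * W := by
    rw [hWs, Finset.mul_sum]; exact Finset.sum_le_sum fun i _ => hXb i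
  have h6 := mul_le_mul_of_nonneg_left h5 (sq_nonneg ((3:ℝ) * 2^j))
  linarith

/-- Frequency-localized estimate of the transport term: for divergence-free
`u ∈ L²(T³)` and `c ∈ C^α(T³)`,
`‖Δ_j(u·∇c)‖_{L²} ≤ C 2^{j(1-α)} ‖u‖_{L²} ‖c‖_{C^α}` for all `j ≥ 0`,
with `C` independent of `j`. -/
theorem block_transport_estimate (χ φ : Td 3 → ℝ) (hLP : LPpair χ φ)
    (α : ℝ) (hα : 0 < α) (hα1 : α < 1) :
    ∃ C > 0, ∀ (u : Td 3 → Td 3) (c : Td 3 → ℝ),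
      ContDiff ℝ (⊤ : ℕ∞) u → (∀ i, TPer fun x => u x i) →
      (∀ x, (∑ i, pd i (fun y => u y i) x) = 0) →
      ContDiff ℝ (⊤ : ℕ∞) c → TPer c →
      ∀ j : ℕ,
        l2NormC (LPblock χ φ (j : ℤ) (fun x => ∑ i, u x i * pd i c x))
          ≤ C * 2 ^ ((j : ℝ) * (1 - α)) *
              Real.sqrt (∫ x in box 3, ∑ i, (u x i)^2) * holderN χ φ α c := by
  obtain ⟨M, hM0, hM⟩ := bdd_of_supp φ hLP.2.1.continuous
    (fun ξ hξ => (hLP.2.2.1 ξ hξ).2.trans (by norm_num))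
  have hq1 : (2:ℝ) ^ (-α) < 1 := Real.rpow_lt_one_of_one_lt_of_neg (by norm_num) (by linarith)
  have hp1 : 1 < (2:ℝ) ^ (1 - α) := Real.one_lt_rpow (by norm_num) (by linarith)
  have hpq : (2:ℝ) ^ (1 - α) = 2 * (2:ℝ) ^ (-α) := by
    rw [sub_eq_add_neg, Real.rpow_add (by norm_num), Real.rpow_one]
  set A0 := (1 - (2:ℝ) ^ (-α))⁻¹ with hA0d
  set B0 := 12 + 6 * ((2:ℝ) ^ (1 - α) - 1)⁻¹ with hB0d
  have hA0 : 0 < A0 := inv_pos.2 (by linarith)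
  have hB0 : 0 < B0 := by
    have : 0 < ((2:ℝ) ^ (1 - α) - 1)⁻¹ := inv_pos.2 (by linarith)
    linarith
  refine ⟨M * (2 * Real.pi) * (2 * (3 * A0 + 2 * B0)), by have := Real.pi_pos; positivity, ?_⟩
  intro u c hu hup hdiv hc hcp j
  have hH := holder_nonneg hLP α hα hα1 c hc hcp
  have hpj : (2:ℝ) ^ ((j:ℝ) * (1 - α)) = ((2:ℝ) ^ (1 - α)) ^ j := by
    rw [← Real.rpow_natCast, ← Real.rpow_mul (by norm_num), mul_comm]
  have hmain := block_sq hLP M hM hu hup hdiv hc hcp j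
    (fun k => (chs χ φ j k : ℂ) * fCoeff c k) _ _
    (fun x => high_bound hLP α hα hα1 c hc hcp j x)
    (fun i x => low_bound hLP α hα hα1 c hc hcp j i x)
  rw [← hA0d, ← hB0d] at hmain
  have hW : 0 ≤ ∫ x in box 3, ∑ i, (u x i)^2 :=
    integral_nonneg fun x => Finset.sum_nonneg fun i _ => sq_nonneg _
  have hpi := Real.pi_pos
  rw [l2NormC, hpj]
  apply Real.sqrt_le_iff.2
  refine ⟨by positivity, hmain.trans ?_⟩
  have e1 : ((3:ℝ) * 2^j)^2 * (((2:ℝ) ^ (-α))^j * (A0 * holderN χ φ α c))^2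
      = (((2:ℝ) ^ (1 - α))^j * holderN χ φ α c)^2 * (9 * A0^2) := by
    rw [hpq, mul_pow 2]; ring
  rw [e1]
  have e2 : (M * (2 * Real.pi) * (2 * (3 * A0 + 2 * B0)) * ((2:ℝ) ^ (1 - α)) ^ j *
      Real.sqrt (∫ x in box 3, ∑ i, (u x i)^2) * holderN χ φ α c)^2
      = (M * (2 * Real.pi))^2 * (4 * ((((2:ℝ) ^ (1 - α))^j * holderN χ φ α c)^2
        * (3 * A0 + 2 * B0)^2)) * (Real.sqrt (∫ x in box 3, ∑ i, (u x i)^2))^2 := by ring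
  rw [e2, Real.sq_sqrt hW]
  apply mul_le_mul_of_nonneg_right _ hW
  apply mul_le_mul_of_nonneg_left _ (sq_nonneg _)
  have e3 : 9 * A0^2 + 3 * B0^2 ≤ (3 * A0 + 2 * B0)^2 := by nlinarith [mul_pos hA0 hB0, sq_nonneg B0]
  have := mul_le_mul_of_nonneg_left e3 (sq_nonneg (((2:ℝ) ^ (1 - α))^j * holderN χ φ α c))
  linarith
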